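/- arXiv:2207.02450 — 2 statements merged into one kernel-verified Lean document; each statement's English description precedes it below -/
import Mathlib

section
/- Let f : ℍ → ℝ be a bounded harmonic function which extends continuously to ℍ ∪ (−ε, 0) ∪ (0, ε) for some ε > 0, with f ≡ a on (−ε, 0) and f ≡ b on (0, ε). Define g : (0,∞) × (0,π) → ℝ by g(r,θ) = f(r e^{iθ}). Then g extends to a real-analytic function g̃ on D := ℝ × (0,π) satisfying: (i) g̃(−r, π−θ) + g̃(r, θ) = a + b for all (r,θ) ∈ D, and (ii) g̃(0, θ) = a·(θ/π) + b·(1 − θ/π) for all θ ∈ (0,π). -/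
open Complex Set Function Filter

/-- The open upper half-plane in `ℂ`. -/
def UHP : Set ℂ := {w : ℂ | 0 < w.im}

/-- A real-valued function on `ℂ ≅ ℝ²` is harmonic on a set if it is `C²` there and its
Laplacian `f_xx + f_yy` vanishes at every point of the set. -/
def HarmonicOn (f : ℂ → ℝ) (s : Set ℂ) : Prop :=
  ContDiffOn ℝ 2 f s ∧
    ∀ z ∈ s, fderiv ℝ (fun w => fderiv ℝ f w 1) z 1 +
      fderiv ℝ (fun w => fderiv ℝ f w Complex.I) z Complex.I = 0

open InnerProductSpace Metric

/-- weak maximum principle -/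
theorem aux_max {K U : Set ℂ} {v : ℂ → ℝ} (hK : IsCompact K) (hU : IsOpen U) (hUK : U ⊆ K)
    (hv : ContinuousOn v K) (hh : ∀ z ∈ U, HarmonicAt v z) (hb : ∀ z ∈ K, z ∉ U → v z ≤ 0) :
    ∀ z ∈ K, v z ≤ 0 := by
  intro z hz
  by_contra hpos
  push Not at hpos
  obtain ⟨w, hwK, hw⟩ := hK.exists_isMaxOn ⟨z, hz⟩ hv
  have hwp : 0 < v w := hpos.trans_le (hw hz)
  set M := K ∩ v ⁻¹' {v w} with hM
  have hMc : IsCompact M :=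
    hK.of_isClosed_subset (hv.preimage_isClosed_of_isClosed hK.isClosed isClosed_singleton)
      inter_subset_left
  obtain ⟨p, hpM, hp⟩ := hMc.exists_isMaxOn ⟨w, hwK, rfl⟩ (Complex.continuous_re.continuousOn)
  have hpv : v p = v w := hpM.2
  have hpU : p ∈ U := by
    by_contra h
    have := hb p hpM.1 h
    linarith
  obtain ⟨R, hR, hRs⟩ := Metric.isOpen_iff.1 hU p hpU
  obtain ⟨F, hF, hFv⟩ := InnerProductSpace.HarmonicOnNhd.exists_analyticOnNhd_ball_re_eq
    (f := v) (z := p) (R := R) (fun y hy => hh y (hRs hy))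
  have hmax : IsLocalMax (norm ∘ fun z => Complex.exp (F z)) p := by
    filter_upwards [Metric.ball_mem_nhds p hR] with y hy
    simp only [Function.comp, Complex.norm_exp]
    apply Real.exp_le_exp.2
    have h1 := hFv hy
    have h2 := hFv (Metric.mem_ball_self hR)
    simp only at h1 h2
    rw [h1, h2, hpv]
    exact hw (hUK (hRs hy))
  have hd : ∀ᶠ y in nhds p, DifferentiableAt ℂ (fun z => Complex.exp (F z)) y := by
    filter_upwards [Metric.ball_mem_nhds p hR] with y hy
    exact (hF y hy).differentiableAt.cexp
  have hc := Complex.norm_eventually_eq_of_isLocalMax hd hmax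
  obtain ⟨R', hR', hc'⟩ := Metric.eventually_nhds_iff_ball.1 (hc.and (Metric.ball_mem_nhds p hR))
  have hq : p + ((R' / 2 : ℝ) : ℂ) ∈ ball p R' := by
    simp [abs_of_pos hR', hR']
  obtain ⟨hq1, hq2⟩ := hc' _ hq
  have hv1 := hFv hq2
  have hv2 := hFv (Metric.mem_ball_self hR)
  simp only [Complex.norm_exp, Real.exp_eq_exp] at hq1 hv1 hv2
  have : (p + ((R' / 2 : ℝ) : ℂ)).re ≤ p.re := by
    refine hp ⟨hUK (hRs hq2), ?_⟩
    simp only [mem_preimage, mem_singleton_iff]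
    rw [← hv1, hq1, hv2, hpv]
  simp at this
  linarith

theorem aux_harm {f : ℂ → ℝ} (hf : HarmonicOn f UHP) {z : ℂ} (hz : z ∈ UHP) :
    HarmonicAt f z := by
  have ho : IsOpen UHP := isOpen_lt continuous_const Complex.continuous_im
  refine ⟨hf.1.contDiffAt (ho.mem_nhds hz), ?_⟩
  filter_upwards [ho.mem_nhds hz] with w hw
  have h1 := hf.2 w hw
  have hd : DifferentiableAt ℝ (fderiv ℝ f) w :=
    ((hf.1.contDiffAt (ho.mem_nhds hw)).fderiv_right (m := 1) (by norm_num)).differentiableAt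
      (by norm_num)
  rw [laplacian_eq_iteratedFDeriv_complexPlane]
  simp only [iteratedFDeriv_two_apply]
  rw [fderiv_clm_apply hd (by fun_prop), fderiv_clm_apply hd (by fun_prop)] at h1
  simpa using h1

theorem aux_trig (p : C(AddCircle (2 * Real.pi), ℂ))
    (hp : p ∈ Submodule.span ℂ (range (fourier (T := 2 * Real.pi)))) :
    ∃ F G : ℂ → ℂ, Differentiable ℂ F ∧ Differentiable ℂ G ∧ ∀ θ : ℝ,
      p (θ : AddCircle (2 * Real.pi)) = F (Complex.exp (θ * I)) +
        (starRingEnd ℂ) (G (Complex.exp (θ * I))) := by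
  induction hp using Submodule.span_induction with
  | mem x hx =>
    obtain ⟨n, rfl⟩ := hx
    obtain ⟨k, rfl | rfl⟩ := n.eq_nat_or_neg
    · refine ⟨fun z => z ^ k, fun _ => 0, by fun_prop, by fun_prop, fun θ => ?_⟩
      rw [fourier_coe_apply]
      simp only [map_zero, add_zero, ← Complex.exp_nat_mul]
      congr 1
      have : (Real.pi : ℂ) ≠ 0 := by exact_mod_cast Real.pi_ne_zero
      push_cast
      field_simp
    · refine ⟨fun _ => 0, fun z => z ^ k, by fun_prop, by fun_prop, fun θ => ?_⟩
      rw [fourier_coe_apply]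
      simp only [zero_add, ← Complex.exp_nat_mul, ← Complex.exp_conj]
      congr 1
      have : (Real.pi : ℂ) ≠ 0 := by exact_mod_cast Real.pi_ne_zero
      simp
      field_simp
  | zero => exact ⟨fun _ => 0, fun _ => 0, by fun_prop, by fun_prop, fun θ => by simp⟩
  | add x y _ _ hx hy =>
    obtain ⟨F, G, hF, hG, h⟩ := hx
    obtain ⟨F', G', hF', hG', h'⟩ := hy
    refine ⟨F + F', G + G', hF.add hF', hG.add hG', fun θ => ?_⟩
    simp [h, h']; ring
  | smul c x _ hx =>
    obtain ⟨F, G, hF, hG, h⟩ := hx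
    refine ⟨fun z => c * F z, fun z => (starRingEnd ℂ) c * G z, by fun_prop, by fun_prop,
      fun θ => ?_⟩
    simp [h]; ring

theorem aux_approx {H : ℂ → ℝ} {ρ : ℝ} (hρ : 0 < ρ) (hc : ContinuousOn H (sphere 0 ρ))
    (hodd : ∀ w, H ((starRingEnd ℂ) w) = - H w) {δ : ℝ} (hδ : 0 < δ) :
    ∃ E : ℂ → ℂ, Differentiable ℂ E ∧ (∀ w, (E ((starRingEnd ℂ) w)).re = - (E w).re) ∧
      ∀ w ∈ sphere (0 : ℂ) ρ, |(E w).re - H w| ≤ δ := by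
  have : Fact (0 < 2 * Real.pi) := ⟨Real.two_pi_pos⟩
  let q : ℝ → ℂ := fun θ => (H (circleMap 0 ρ θ) : ℂ)
  have hq : Continuous q := by
    refine Complex.continuous_ofReal.comp (hc.comp_continuous (continuous_circleMap 0 ρ) ?_)
    intro θ
    exact circleMap_mem_sphere 0 hρ.le θ
  have hper : Function.Periodic q (2 * Real.pi) := by
    intro θ
    simp [q, periodic_circleMap 0 ρ θ]
  let Q : C(AddCircle (2 * Real.pi), ℂ) := ⟨hper.lift, continuous_coinduced_dom.2 hq⟩
  have hQ : Q ∈ (Submodule.span ℂ (range (fourier (T := 2 * Real.pi)))).topologicalClosure := by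
    rw [span_fourier_closure_eq_top]; trivial
  obtain ⟨p, hp, hpd⟩ := Metric.mem_closure_iff.1 hQ δ hδ
  obtain ⟨F, G, hF, hG, h⟩ := aux_trig p hp
  let A : ℂ → ℂ := fun w => F (w / ρ) + G (w / ρ)
  have hA : Differentiable ℂ A := by
    have : Differentiable ℂ (fun w : ℂ => w / ρ) := by fun_prop
    exact (hF.comp this).add (hG.comp this)
  have hAb : ∀ w ∈ sphere (0 : ℂ) ρ, |(A w).re - H w| ≤ δ := by
    intro w hw
    have hw' : ‖w‖ = ρ := by simpa using hw
    have hρ' : (ρ : ℂ) ≠ 0 := by exact_mod_cast hρ.ne'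
    have hww : circleMap 0 ρ w.arg = w := by
      rw [circleMap_zero, ← hw']; exact Complex.norm_mul_exp_arg_mul_I w
    have hwe : Complex.exp (w.arg * I) = w / ρ := by
      rw [eq_div_iff hρ', mul_comm, ← circleMap_zero, hww]
    have h1 : dist (Q (w.arg : AddCircle (2 * Real.pi))) (p (w.arg : AddCircle (2 * Real.pi))) < δ :=
      (ContinuousMap.dist_apply_le_dist _).trans_lt hpd
    have h2 : Q (w.arg : AddCircle (2 * Real.pi)) = (H w : ℂ) := by
      change q w.arg = _
      simp only [q, hww]
    rw [h2, h, hwe, dist_comm, dist_eq_norm] at h1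
    refine le_trans ?_ h1.le
    refine le_trans (le_of_eq ?_) (Complex.abs_re_le_norm _)
    simp [A]
  refine ⟨fun w => (A w - (starRingEnd ℂ) (A ((starRingEnd ℂ) w))) / 2, ?_, ?_, ?_⟩
  · have : Differentiable ℂ (fun w => (starRingEnd ℂ) (A ((starRingEnd ℂ) w))) := fun w =>
      differentiableAt_conj_conj_iff.2 (hA _)
    fun_prop
  · intro w
    simp
    ring
  · intro w hw
    have h1 := hAb w hw
    have h2 := hAb ((starRingEnd ℂ) w) (by simpa using hw)
    rw [hodd] at h2
    simp
    rw [abs_le] at *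
    constructor <;> linarith [h1.1, h1.2, h2.1, h2.2]

theorem aux_poisson_analytic {H : ℂ → ℝ} {ρ : ℝ} (hρ : 0 < ρ)
    (hc : ContinuousOn H (sphere 0 ρ)) :
    AnalyticAt ℝ (fun w => Real.circleAverage ((re ∘ herglotzRieszKernel 0 w) • H) 0 ρ) 0 := by
  have hci : ContinuousOn (fun z => (H z : ℂ)) (sphere 0 ρ) :=
    Complex.continuous_ofReal.comp_continuousOn hc
  have hint : CircleIntegrable (fun z => (H z : ℂ)) 0 ρ := hci.circleIntegrable hρ.le
  have hA : AnalyticAt ℂ (fun w : ℂ => (2 * Real.pi * I : ℂ)⁻¹ •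
      ∮ z in C(0, ρ), (z - w)⁻¹ • (H z : ℂ)) 0 :=
    (hasFPowerSeriesOn_cauchy_integral (R := ⟨ρ, hρ.le⟩) hint hρ).analyticAt
  have hB : AnalyticAt ℂ (fun w : ℂ => 2 * ((2 * Real.pi * I : ℂ)⁻¹ •
      ∮ z in C(0, ρ), (z - w)⁻¹ • (H z : ℂ)) - Real.circleAverage (fun z => (H z : ℂ)) 0 ρ) 0 :=
    (analyticAt_const.mul hA).sub analyticAt_const
  have hC : AnalyticAt ℝ (fun w : ℂ => reCLM (2 * ((2 * Real.pi * I : ℂ)⁻¹ •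
      ∮ z in C(0, ρ), (z - w)⁻¹ • (H z : ℂ)) - Real.circleAverage (fun z => (H z : ℂ)) 0 ρ)) 0 :=
    (reCLM.analyticAt _).comp hB.restrictScalars
  refine hC.congr ?_
  filter_upwards [Metric.ball_mem_nhds (0 : ℂ) hρ] with w hw
  have hne : ∀ z ∈ sphere (0 : ℂ) ρ, z - w ≠ 0 := by
    intro z hz h
    rw [sub_eq_zero] at h
    subst h
    simp at hz hw
    linarith
  have hk : ContinuousOn (fun z => herglotzRieszKernel 0 w z * (H z : ℂ)) (sphere 0 ρ) := by
    refine ContinuousOn.mul ?_ hci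
    simp only [herglotzRieszKernel_fun_def, sub_zero]
    exact ContinuousOn.div (by fun_prop) (by fun_prop) hne
  have hk2 : ContinuousOn (fun z => 2 * (z * ((z - w)⁻¹ * (H z : ℂ)))) (sphere 0 ρ) := by
    refine continuousOn_const.mul (continuousOn_id.mul (ContinuousOn.mul ?_ hci))
    exact ContinuousOn.inv₀ (by fun_prop) hne
  have e1 : ((re ∘ herglotzRieszKernel 0 w) • H) =
      reCLM ∘ (fun z => herglotzRieszKernel 0 w z * (H z : ℂ)) := by
    ext z; simp
  rw [e1, reCLM.circleAverage_comp_comm (hk.circleIntegrable hρ.le)]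
  congr 1
  have e2 : Real.circleAverage (fun z => herglotzRieszKernel 0 w z * (H z : ℂ)) 0 ρ =
      Real.circleAverage (fun z => 2 * (z * ((z - w)⁻¹ * (H z : ℂ))) - (H z : ℂ)) 0 ρ := by
    apply Real.circleAverage_congr_sphere
    rw [abs_of_pos hρ]
    intro z hz
    have := hne z hz
    simp only [herglotzRieszKernel_def, sub_zero]
    field_simp
    ring
  rw [e2, Real.circleAverage_fun_sub (hk2.circleIntegrable hρ.le) hint]
  congr 1
  rw [Real.circleAverage_eq_circleIntegral hρ.ne']
  have e3 : (∮ z in C(0, ρ), (z - 0)⁻¹ • (2 * (z * ((z - w)⁻¹ * (H z : ℂ))))) =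
      ∮ z in C(0, ρ), (2 : ℂ) • ((z - w)⁻¹ • (H z : ℂ)) := by
    apply circleIntegral.integral_congr hρ.le
    intro z hz
    have : z ≠ 0 := by
      rintro rfl
      simp at hz
      linarith
    simp only [sub_zero, smul_eq_mul]
    field_simp
  rw [e3, circleIntegral.integral_smul]
  simp only [smul_eq_mul]
  ring

theorem aux_limit {H : ℂ → ℝ} {ρ : ℝ} (hρ : 0 < ρ) (hc : ContinuousOn H (sphere 0 ρ))
    (happ : ∀ δ > 0, ∃ E : ℂ → ℂ, Differentiable ℂ E ∧
      ∀ w ∈ closedBall (0 : ℂ) ρ, |(E w).re - H w| ≤ δ) : AnalyticAt ℝ H 0 := by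
  refine (aux_poisson_analytic hρ hc).congr ?_
  filter_upwards [Metric.ball_mem_nhds (0 : ℂ) hρ] with w hw
  have hne : ∀ z ∈ sphere (0 : ℂ) ρ, z - w ≠ 0 := by
    intro z hz h
    rw [sub_eq_zero] at h
    subst h
    simp at hz hw
    linarith
  have hkc : ContinuousOn (re ∘ herglotzRieszKernel 0 w) (sphere 0 ρ) := by
    refine Complex.continuous_re.comp_continuousOn ?_
    simp only [herglotzRieszKernel_fun_def, sub_zero]
    exact ContinuousOn.div (by fun_prop) (by fun_prop) hne
  obtain ⟨C, hC⟩ := (isCompact_sphere (0 : ℂ) ρ).exists_bound_of_continuousOn hkc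
  have hC0 : 0 ≤ C := (norm_nonneg _).trans (hC ρ (by simp [abs_of_pos hρ]))
  apply eq_of_abs_sub_le_all
  intro ε hε
  obtain ⟨E, hE, hEH⟩ := happ (ε / (C + 1)) (by positivity)
  have hEp : Real.circleAverage ((re ∘ herglotzRieszKernel 0 w) • (fun z => (E z).re)) 0 ρ
      = (E w).re :=
    HarmonicOnNhd.circleAverage_re_herglotzRieszKernel_smul
      (fun z _ => (hE.analyticAt z).harmonicAt_re) hw
  have hEc : ContinuousOn (fun z => (E z).re) (sphere 0 ρ) :=
    (Complex.continuous_re.comp hE.continuous).continuousOn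
  have i1 := (hkc.smul hc).circleIntegrable hρ.le
  have i2 := (hkc.smul hEc).circleIntegrable hρ.le
  have hdiff := Real.circleAverage_sub i2 i1
  have hb : |Real.circleAverage ((re ∘ herglotzRieszKernel 0 w) • (fun z => (E z).re) -
      (re ∘ herglotzRieszKernel 0 w) • H) 0 ρ| ≤ C * (ε / (C + 1)) := by
    refine Real.abs_circleAverage_le_circleAverage_abs.trans ?_
    refine Real.circleAverage_mono_on_of_le_circle ?_ ?_
    · exact (((hkc.smul hEc).sub (hkc.smul hc)).abs).circleIntegrable hρ.le
    · rw [abs_of_pos hρ]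
      intro z hz
      have h1 := hC z hz
      have h2 := hEH z (sphere_subset_closedBall hz)
      rw [Real.norm_eq_abs] at h1
      simp only [Pi.abs_apply, Pi.sub_apply, Pi.mul_apply, smul_eq_mul]
      rw [← mul_sub, abs_mul]
      exact mul_le_mul h1 h2 (abs_nonneg _) hC0
  have hw2 := hEH w (ball_subset_closedBall hw)
  have h3 : C * (ε / (C + 1)) + ε / (C + 1) = ε := by field_simp
  have hdiff' : Real.circleAverage ((re ∘ herglotzRieszKernel 0 w) • (fun z => (E z).re) -
      (re ∘ herglotzRieszKernel 0 w) • H) 0 ρ = (E w).re -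
        Real.circleAverage ((re ∘ herglotzRieszKernel 0 w) • H) 0 ρ := by
    rw [← hEp]; exact hdiff
  rw [hdiff'] at hb
  rw [abs_le] at *
  constructor <;> linarith [hb.1, hb.2, hw2.1, hw2.2]

theorem aux_half {u : ℂ → ℝ} {ρ B δ : ℝ} (hρ : 0 < ρ)
    (hu : ∀ z : ℂ, 0 < z.im → HarmonicAt u z)
    (hc : ContinuousOn u {z : ℂ | 0 ≤ z.im ∧ z ≠ 0 ∧ ‖z‖ ≤ ρ})
    (hB : ∀ z : ℂ, 0 < z.im → ‖z‖ ≤ ρ → u z ≤ B)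
    (h0 : ∀ z : ℂ, z.im = 0 → z ≠ 0 → ‖z‖ ≤ ρ → u z ≤ δ)
    (h1 : ∀ z : ℂ, 0 ≤ z.im → ‖z‖ = ρ → u z ≤ δ) :
    ∀ w : ℂ, 0 < w.im → ‖w‖ ≤ ρ → u w ≤ δ := by
  intro w hw hwρ
  have hw0 : w ≠ 0 := by rintro rfl; simp at hw
  have hwn : 0 < ‖w‖ := norm_pos_iff.2 hw0
  have key : ∀ η > 0, u w - δ - η * (Real.log ρ - Real.log ‖w‖) ≤ 0 := by
    intro η hη
    set r := min ‖w‖ (ρ * Real.exp (-(|B - δ|) / η)) with hr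
    have hr0 : 0 < r := lt_min hwn (by positivity)
    have hrw : r ≤ ‖w‖ := min_le_left _ _
    have hrl : |B - δ| ≤ η * (Real.log ρ - Real.log r) := by
      have : Real.log r ≤ Real.log ρ + (-(|B - δ|) / η) := by
        rw [← Real.log_exp (-(|B - δ|) / η), ← Real.log_mul hρ.ne' (Real.exp_pos _).ne']
        exact Real.log_le_log hr0 (min_le_right _ _)
      have h2 : |B - δ| / η ≤ Real.log ρ - Real.log r := by
        rw [neg_div] at this; linarith
      rw [div_le_iff₀ hη] at h2
      linarith
    refine aux_max (K := {z : ℂ | 0 ≤ z.im ∧ r ≤ ‖z‖ ∧ ‖z‖ ≤ ρ})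
      (U := {z : ℂ | 0 < z.im ∧ r < ‖z‖ ∧ ‖z‖ < ρ})
      (v := fun z => u z - δ - η * (Real.log ρ - Real.log ‖z‖)) ?_ ?_ ?_ ?_ ?_ ?_ w
      ⟨hw.le, hrw, hwρ⟩
    · refine (isCompact_closedBall (0 : ℂ) ρ).of_isClosed_subset ?_ ?_
      · exact (isClosed_le continuous_const Complex.continuous_im).inter
          ((isClosed_le continuous_const continuous_norm).inter
            (isClosed_le continuous_norm continuous_const))
      · rintro z ⟨_, _, h⟩
        simpa using h
    · exact (isOpen_lt continuous_const Complex.continuous_im).inter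
          ((isOpen_lt continuous_const continuous_norm).inter
            (isOpen_lt continuous_norm continuous_const))
    · rintro z ⟨h1, h2, h3⟩
      exact ⟨h1.le, h2.le, h3.le⟩
    · have hne : ∀ z ∈ {z : ℂ | 0 ≤ z.im ∧ r ≤ ‖z‖ ∧ ‖z‖ ≤ ρ}, ‖z‖ ≠ 0 := by
        rintro z ⟨_, h, _⟩
        linarith
      refine ((hc.mono ?_).sub continuousOn_const).sub
        (continuousOn_const.mul (continuousOn_const.sub
          (continuous_norm.continuousOn.log hne)))
      rintro z hz
      exact ⟨hz.1, norm_ne_zero_iff.1 (hne z hz), hz.2.2⟩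
    · rintro z ⟨hz, hz2, _⟩
      have hz0 : z ≠ 0 := by rintro rfl; simp at hz
      have hl : HarmonicAt (fun z : ℂ => Real.log ‖z‖) z :=
        (analyticAt_id (𝕜 := ℂ) (z := z)).harmonicAt_log_norm hz0
      exact ((hu z hz).sub (harmonicAt_const δ)).sub
        (((harmonicAt_const (Real.log ρ)).sub hl).const_smul (c := η))
    · rintro z ⟨hz1, hz2, hz3⟩ hzU
      have hzn : 0 < ‖z‖ := hr0.trans_le hz2
      have hlog : 0 ≤ η * (Real.log ρ - Real.log ‖z‖) :=
        mul_nonneg hη.le (sub_nonneg.2 (Real.log_le_log hzn hz3))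
      rcases hz1.eq_or_lt with h | h
      · linarith [h0 z h.symm (norm_pos_iff.1 hzn) hz3]
      rcases hz3.eq_or_lt with h3 | h3
      · linarith [h1 z hz1 h3]
      rcases hz2.eq_or_lt with h2 | h2
      · rw [← h2]
        linarith [hB z h hz3, le_abs_self (B - δ)]
      · exact absurd ⟨h, h2, h3⟩ hzU
  have hL : 0 ≤ Real.log ρ - Real.log ‖w‖ := sub_nonneg.2 (Real.log_le_log hwn hwρ)
  apply le_of_forall_pos_le_add
  intro e he
  have := key (e / (Real.log ρ - Real.log ‖w‖ + 1)) (by positivity)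
  have h2 : e / (Real.log ρ - Real.log ‖w‖ + 1) * (Real.log ρ - Real.log ‖w‖) ≤ e := by
    rw [div_mul_eq_mul_div, div_le_iff₀ (by linarith)]
    nlinarith
  linarith

/-- odd reflection -/
noncomputable def oddRefl (h : ℂ → ℝ) (w : ℂ) : ℝ :=
  if 0 < w.im then h w else if w.im < 0 then - h ((starRingEnd ℂ) w) else 0

theorem oddRefl_odd (h : ℂ → ℝ) (w : ℂ) :
    oddRefl h ((starRingEnd ℂ) w) = - oddRefl h w := by
  unfold oddRefl
  rcases lt_trichotomy w.im 0 with h1 | h1 | h1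
  · simp [h1, h1.not_gt]
  · simp [h1]
  · simp [h1, h1.not_gt]

theorem aux_reflect {h : ℂ → ℝ} {ε M : ℝ} (hε : 0 < ε)
    (hh : ∀ z : ℂ, 0 < z.im → HarmonicAt h z)
    (hM : ∀ z : ℂ, 0 < z.im → |h z| ≤ M)
    (hc : ContinuousOn h {z : ℂ | 0 ≤ z.im ∧ z ≠ 0 ∧ ‖z‖ < ε})
    (h0 : ∀ z : ℂ, z.im = 0 → z ≠ 0 → ‖z‖ < ε → h z = 0) :
    AnalyticAt ℝ (oddRefl h) 0 := by
  set ρ := ε / 2 with hρd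
  have hρ : 0 < ρ := by positivity
  have hρε : ρ < ε := by simp [hρd, hε]
  have heq : ∀ z : ℂ, 0 ≤ z.im → z ≠ 0 → ‖z‖ < ε → oddRefl h z = h z := by
    intro z hz hz0 hzε
    unfold oddRefl
    rcases hz.eq_or_lt with h1 | h1
    · simp [← h1, h0 z h1.symm hz0 hzε]
    · simp [h1]
  have hs0 : ∀ z ∈ sphere (0 : ℂ) ρ, z ≠ 0 ∧ ‖z‖ < ε := by
    intro z hz
    have hz' : ‖z‖ = ρ := by simpa using hz
    exact ⟨norm_pos_iff.1 (by linarith), by linarith⟩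
  have hup : ContinuousOn (oddRefl h) (sphere 0 ρ ∩ {z : ℂ | 0 ≤ z.im}) := by
    refine (hc.mono ?_).congr ?_
    · rintro z ⟨h1, h2⟩
      exact ⟨h2, hs0 z h1⟩
    · rintro z ⟨h1, h2⟩
      exact heq z h2 (hs0 z h1).1 (hs0 z h1).2
  have hlo : ContinuousOn (oddRefl h) (sphere 0 ρ ∩ {z : ℂ | z.im ≤ 0}) := by
    have : ContinuousOn (fun z => - oddRefl h ((starRingEnd ℂ) z))
        (sphere 0 ρ ∩ {z : ℂ | z.im ≤ 0}) := by
      refine (hup.comp Complex.continuous_conj.continuousOn ?_).neg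
      rintro z ⟨h1, h2⟩
      refine ⟨by simpa using h1, ?_⟩
      simpa using h2
    refine this.congr ?_
    intro z _
    simp [oddRefl_odd]
  have hcs : ContinuousOn (oddRefl h) (sphere 0 ρ) := by
    have := hup.union_of_isClosed hlo
      (isClosed_sphere.inter (isClosed_le continuous_const Complex.continuous_im))
      (isClosed_sphere.inter (isClosed_le Complex.continuous_im continuous_const))
    refine this.mono ?_
    intro z hz
    rcases le_total 0 z.im with h1 | h1
    · exact Or.inl ⟨hz, h1⟩
    · exact Or.inr ⟨hz, h1⟩
  refine aux_limit hρ hcs ?_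
  intro δ hδ
  obtain ⟨E, hE, hEo, hEb⟩ := aux_approx hρ hcs (oddRefl_odd h) hδ
  refine ⟨E, hE, ?_⟩
  have hEreal : ∀ z : ℂ, z.im = 0 → (E z).re = 0 := by
    intro z hz
    have := hEo z
    rw [Complex.conj_eq_iff_im.2 hz] at this
    linarith
  have hEc : Continuous (fun z => (E z).re) := Complex.continuous_re.comp hE.continuous
  have hEh : ∀ z, HarmonicAt (fun z => (E z).re) z := fun z => (hE.analyticAt z).harmonicAt_re
  obtain ⟨C, hC⟩ := (isCompact_closedBall (0 : ℂ) ρ).exists_bound_of_continuousOn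
    hEc.continuousOn
  have hc' : ContinuousOn h {z : ℂ | 0 ≤ z.im ∧ z ≠ 0 ∧ ‖z‖ ≤ ρ} := hc.mono (by
    rintro z ⟨h1, h2, h3⟩
    exact ⟨h1, h2, h3.trans_lt hρε⟩)
  have hbd : ∀ z : ℂ, 0 < z.im → ‖z‖ ≤ ρ → |(E z).re - h z| ≤ C + M := by
    intro z hz hzρ
    have h1 := hC z (by simpa using hzρ)
    have h2 := hM z hz
    rw [Real.norm_eq_abs] at h1
    exact (abs_sub _ _).trans (add_le_add h1 h2)
  have hreal : ∀ z : ℂ, z.im = 0 → z ≠ 0 → ‖z‖ ≤ ρ → (E z).re - h z = 0 := by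
    intro z hz hz0 hzρ
    rw [hEreal z hz, h0 z hz hz0 (hzρ.trans_lt hρε), sub_zero]
  have harc : ∀ z : ℂ, 0 ≤ z.im → ‖z‖ = ρ → |(E z).re - h z| ≤ δ := by
    intro z hz hzρ
    have hzs : z ∈ sphere (0 : ℂ) ρ := by simpa using hzρ
    rw [← heq z hz (hs0 z hzs).1 (hs0 z hzs).2]
    exact hEb z hzs
  have hupper : ∀ w : ℂ, 0 < w.im → ‖w‖ ≤ ρ → |(E w).re - h w| ≤ δ := by
    intro w hw hwρ
    have a1 := aux_half (u := fun z => (E z).re - h z) (B := C + M) (δ := δ) hρ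
      (fun z hz => (hEh z).sub (hh z hz)) (hEc.continuousOn.sub hc')
      (fun z hz hzρ => (le_abs_self _).trans (hbd z hz hzρ))
      (fun z hz hz0 hzρ => (hreal z hz hz0 hzρ).le.trans hδ.le)
      (fun z hz hzρ => (le_abs_self _).trans (harc z hz hzρ)) w hw hwρ
    have a2 := aux_half (u := fun z => h z - (E z).re) (B := C + M) (δ := δ) hρ
      (fun z hz => (hh z hz).sub (hEh z)) (hc'.sub hEc.continuousOn)
      (fun z hz hzρ => (neg_sub (E z).re (h z) ▸ neg_le_abs _).trans (hbd z hz hzρ))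
      (fun z hz hz0 hzρ => by linarith [hreal z hz hz0 hzρ])
      (fun z hz hzρ => (neg_sub (E z).re (h z) ▸ neg_le_abs _).trans (harc z hz hzρ)) w hw hwρ
    rw [abs_le]
    constructor <;> linarith
  intro w hw
  have hw' : ‖w‖ ≤ ρ := by simpa using hw
  rcases lt_trichotomy w.im 0 with h1 | h1 | h1
  · have := hupper ((starRingEnd ℂ) w) (by simpa using h1) (by simpa using hw')
    rw [hEo] at this
    have e : oddRefl h w = - h ((starRingEnd ℂ) w) := by simp [oddRefl, h1, h1.not_gt]
    rw [e, ← abs_neg]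
    convert this using 2
    ring
  · have e : oddRefl h w = 0 := by simp [oddRefl, h1]
    rw [e, hEreal w h1]
    simpa using hδ.le
  · have e : oddRefl h w = h w := by simp [oddRefl, h1]
    rw [e]
    exact hupper w h1 hw'

theorem aux_analytic_off {h : ℂ → ℝ} (hh : ∀ z : ℂ, 0 < z.im → HarmonicAt h z)
    {z : ℂ} (hz : z.im ≠ 0) : AnalyticAt ℝ (oddRefl h) z := by
  have up : ∀ w : ℂ, 0 < w.im → AnalyticAt ℝ (oddRefl h) w := by
    intro w hw
    refine (HarmonicAt.analyticAt (hh w hw)).congr ?_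
    filter_upwards [(isOpen_lt continuous_const Complex.continuous_im).mem_nhds hw] with y hy
    have hy' : 0 < y.im := hy
    simp [oddRefl, hy']
  rcases lt_or_gt_of_ne hz with h1 | h1
  · have e : oddRefl h = fun w => - oddRefl h (conjCLE w) := by
      ext w
      simp [oddRefl_odd]
    rw [e]
    refine AnalyticAt.neg ?_
    have hc : AnalyticAt ℝ (fun w : ℂ => conjCLE w) z :=
      (conjCLE : ℂ →L[ℝ] ℂ).analyticAt z
    exact AnalyticAt.fun_comp (g := oddRefl h) (f := fun w : ℂ => conjCLE w)
      (up _ (by simpa using h1)) hc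
  · exact up z h1

theorem aux_arg_cont : ContinuousOn Complex.arg {z : ℂ | 0 ≤ z.im ∧ z ≠ 0} := by
  rintro z ⟨hz, hz0⟩
  by_cases hs : z ∈ slitPlane
  · exact (Complex.continuousAt_arg hs).continuousWithinAt
  · rw [Complex.mem_slitPlane_iff] at hs
    push Not at hs
    have hre : z.re < 0 := lt_of_le_of_ne hs.1 (fun h => hz0 (Complex.ext h hs.2))
    exact (Complex.continuousWithinAt_arg_of_re_neg_of_im_zero hre hs.2).mono (fun w hw => hw.1)

/-- **Real-analytic continuation of a bounded harmonic function with a boundary jump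
(Akamine–Fujino).** If `f` is bounded harmonic on `ℍ`, continuous up to
`(-ε,0) ∪ (0,ε) ⊆ ∂ℍ` with `f ≡ a` on `(-ε,0)` and `f ≡ b` on `(0,ε)`, then
`g(r,θ) := f(r e^{iθ})`, defined on `(0,∞) × (0,π)`, extends real-analytically to
`D = ℝ × (0,π)`, and the extension `g̃` satisfies
`g̃(-r, π-θ) + g̃(r,θ) = a + b` on `D` and `g̃(0,θ) = a·θ/π + b·(1-θ/π)`. -/
theorem harmonic_jump_blowup_extension
    (f : ℂ → ℝ) (a b : ℝ) (ε : ℝ) (hε : 0 < ε)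
    (hf : HarmonicOn f UHP)
    (hbd : ∃ M : ℝ, ∀ w ∈ UHP, |f w| ≤ M)
    (hfc : ContinuousOn f
      (UHP ∪ (Complex.ofReal '' (Set.Ioo (-ε) 0 ∪ Set.Ioo 0 ε))))
    (hfa : ∀ s ∈ Set.Ioo (-ε) 0, f (s : ℂ) = a)
    (hfb : ∀ s ∈ Set.Ioo 0 ε, f (s : ℂ) = b) :
    ∃ g : ℝ × ℝ → ℝ,
      AnalyticOnNhd ℝ g (Set.univ ×ˢ Set.Ioo 0 Real.pi) ∧
      (∀ r : ℝ, 0 < r → ∀ θ ∈ Set.Ioo 0 Real.pi,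
        g (r, θ) = f ((r : ℂ) * Complex.exp ((θ : ℂ) * Complex.I))) ∧
      (∀ r : ℝ, ∀ θ ∈ Set.Ioo 0 Real.pi,
        g (-r, Real.pi - θ) + g (r, θ) = a + b) ∧
      (∀ θ ∈ Set.Ioo 0 Real.pi,
        g (0, θ) = a * (θ / Real.pi) + b * (1 - θ / Real.pi)) := by
  have hpi : Real.pi ≠ 0 := Real.pi_ne_zero
  obtain ⟨M, hM⟩ := hbd
  set h : ℂ → ℝ := fun w => f w - (b + ((a - b) / Real.pi) * w.arg) with hdef
  have hh : ∀ z : ℂ, 0 < z.im → HarmonicAt h z := by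
    intro z hz
    have hlog : HarmonicAt (fun w : ℂ => w.arg) z := by
      have := (analyticAt_clog (z := z) (Or.inr hz.ne')).harmonicAt_im
      simpa only [Complex.log_im] using this
    exact (aux_harm hf hz).sub
      ((harmonicAt_const b).add (hlog.const_smul (c := (a - b) / Real.pi)))
  have hMb : ∀ z : ℂ, 0 < z.im → |h z| ≤ M + (|b| + |(a - b) / Real.pi| * Real.pi) := by
    intro z hz
    refine (abs_sub _ _).trans (add_le_add (hM z hz) ((abs_add_le _ _).trans ?_))
    rw [abs_mul]
    gcongr
    exact Complex.abs_arg_le_pi z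
  have hreal : ∀ z : ℂ, z.im = 0 → z ≠ 0 → ‖z‖ < ε →
      z = (z.re : ℂ) ∧ (z.re ∈ Set.Ioo (-ε) 0 ∨ z.re ∈ Set.Ioo 0 ε) := by
    intro z hz hz0 hzε
    have e : z = (z.re : ℂ) := Complex.ext (by simp) (by simp [hz])
    refine ⟨e, ?_⟩
    have h1 := (Complex.abs_re_le_norm z).trans_lt hzε
    rw [abs_lt] at h1
    have h2 : z.re ≠ 0 := fun h => hz0 (Complex.ext h hz)
    rcases lt_or_gt_of_ne h2 with h3 | h3
    · exact Or.inl ⟨h1.1, h3⟩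
    · exact Or.inr ⟨h3, h1.2⟩
  have hc : ContinuousOn h {z : ℂ | 0 ≤ z.im ∧ z ≠ 0 ∧ ‖z‖ < ε} := by
    refine (hfc.mono ?_).sub (continuousOn_const.add (continuousOn_const.mul
      (aux_arg_cont.mono ?_)))
    · rintro z ⟨h1, h2, h3⟩
      rcases h1.eq_or_lt with h1 | h1
      · obtain ⟨e, h4⟩ := hreal z h1.symm h2 h3
        exact Or.inr ⟨z.re, h4, e.symm⟩
      · exact Or.inl h1
    · rintro z ⟨h1, h2, _⟩
      exact ⟨h1, h2⟩
  have h0 : ∀ z : ℂ, z.im = 0 → z ≠ 0 → ‖z‖ < ε → h z = 0 := by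
    intro z hz hz0 hzε
    obtain ⟨e, h4 | h4⟩ := hreal z hz hz0 hzε
    · have h5 : z.arg = Real.pi := Complex.arg_eq_pi_iff.2 ⟨h4.2, hz⟩
      have h6 : f z = a := by rw [e]; exact hfa _ h4
      simp only [hdef, h5, h6]
      field_simp
      ring
    · have h5 : z.arg = 0 := Complex.arg_eq_zero_iff.2 ⟨h4.1.le, hz⟩
      have h6 : f z = b := by rw [e]; exact hfb _ h4
      simp only [hdef, h5, h6]
      ring
  have han0 := aux_reflect hε hh hMb hc h0
  have him : ∀ r θ : ℝ, ((r : ℂ) * Complex.exp ((θ : ℂ) * Complex.I)).im = r * Real.sin θ := by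
    intro r θ
    simp [Complex.exp_ofReal_mul_I_im]
  refine ⟨fun p => oddRefl h ((p.1 : ℂ) * Complex.exp ((p.2 : ℂ) * Complex.I)) +
    (b + ((a - b) / Real.pi) * p.2), ?_, ?_, ?_, ?_⟩
  · rintro ⟨r, θ⟩ ⟨_, hθ⟩
    have hsin : 0 < Real.sin θ := Real.sin_pos_of_mem_Ioo hθ
    have hO : AnalyticAt ℝ (oddRefl h) ((r : ℂ) * Complex.exp ((θ : ℂ) * Complex.I)) := by
      by_cases hr : r = 0
      · simpa [hr] using han0
      · exact aux_analytic_off hh (by rw [him]; positivity)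
    have a1 : AnalyticAt ℝ (fun p : ℝ × ℝ => (p.1 : ℂ)) (r, θ) :=
      AnalyticAt.fun_comp (g := fun x : ℝ => (x : ℂ)) (ofRealCLM.analyticAt _) analyticAt_fst
    have a2 : AnalyticAt ℝ (fun p : ℝ × ℝ => (p.2 : ℂ)) (r, θ) :=
      AnalyticAt.fun_comp (g := fun x : ℝ => (x : ℂ)) (ofRealCLM.analyticAt _) analyticAt_snd
    have a3 : AnalyticAt ℝ (fun p : ℝ × ℝ => Complex.exp ((p.2 : ℂ) * Complex.I)) (r, θ) :=
      AnalyticAt.fun_comp (g := Complex.exp) (analyticAt_cexp.restrictScalars)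
        (a2.mul analyticAt_const)
    refine AnalyticAt.add ?_ (analyticAt_const.add (analyticAt_const.mul analyticAt_snd))
    exact AnalyticAt.fun_comp (g := oddRefl h) hO (a1.mul a3)
  · intro r hr θ hθ
    have hsin : 0 < Real.sin θ := Real.sin_pos_of_mem_Ioo hθ
    have hp : 0 < ((r : ℂ) * Complex.exp ((θ : ℂ) * Complex.I)).im := by
      rw [him]; positivity
    have harg : ((r : ℂ) * Complex.exp ((θ : ℂ) * Complex.I)).arg = θ := by
      rw [Complex.exp_mul_I]
      exact Complex.arg_mul_cos_add_sin_mul_I hr ⟨by linarith [hθ.1, Real.pi_pos], hθ.2.le⟩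
    simp only [oddRefl, hp, if_true, hdef, harg]
    ring
  · intro r θ hθ
    have e : (((-r : ℝ) : ℂ) * Complex.exp (((Real.pi - θ : ℝ) : ℂ) * Complex.I)) =
        (starRingEnd ℂ) ((r : ℂ) * Complex.exp ((θ : ℂ) * Complex.I)) := by
      rw [map_mul, ← Complex.exp_conj]
      push_cast
      rw [sub_mul, Complex.exp_sub, Complex.exp_pi_mul_I]
      simp [Complex.exp_neg]
      ring
    simp only
    rw [e, oddRefl_odd]
    field_simp
    ring
  · intro θ hθ
    have : oddRefl h 0 = 0 := by simp [oddRefl]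
    simp only [Complex.ofReal_zero, zero_mul, this]
    field_simp
    ring
end

section
/- Let ε > 0 and a ≠ b be real numbers. Let h : ℍ → ℂ be an injective holomorphic map extending continuously and injectively to ℍ ∪ (−ε, ε) with h((−ε,ε)) contained in the real axis ℝ ⊂ ℂ (so that the isotropic boundary segment connects two parallel horizontal straight line segments of the surface whose projections lie on the x-axis), and let t : ℍ → ℝ be a bounded harmonic function extending continuously to ℍ ∪ (−ε,0) ∪ (0,ε) with t ≡ a on (−ε, 0) and t ≡ b on (0, ε). Then the real-analytic extension X̃ of X ∘ Π to ℝ × (0,π), where X = (h,t) and Π(r,θ) = r e^{iθ}, satisfies X̃(−r, π−θ) = ( conj( h(r e^{iθ}) ), a + b − t(r e^{iθ}) ) for all r > 0, θ ∈ (0,π); i.e., the surface extends across the isotropic line L via the symmetry (x,y,t) ↦ (x, −y, a+b−t) with respect to the horizontal line parallel to the x-axis passing through the midpoint of L. -/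
open Complex Set Function Filter

open InnerProductSpace in
lemma harm_conv {f : ℂ → ℝ} (hf : HarmonicOn f UHP) : HarmonicOnNhd f UHP := by
  have hopen : IsOpen UHP := isOpen_lt continuous_const Complex.continuous_im
  intro z hz
  refine ⟨hf.1.contDiffAt (hopen.mem_nhds hz), ?_⟩
  filter_upwards [hopen.mem_nhds hz] with w hw
  have h1 : ContDiffAt ℝ 2 f w := hf.1.contDiffAt (hopen.mem_nhds hw)
  have h2 : DifferentiableAt ℝ (fderiv ℝ f) w :=
    (h1.fderiv_right (m := 1) (by norm_num)).differentiableAt (by norm_num)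
  have h3 := hf.2 w hw
  rw [laplacian_eq_iteratedFDeriv_complexPlane]
  simp only [iteratedFDeriv_two_apply]
  rw [fderiv_clm_apply h2 (by fun_prop), fderiv_clm_apply h2 (by fun_prop)] at h3
  simpa using h3

open InnerProductSpace in
lemma harm_max {Ω : Set ℂ} (hΩ : IsOpen Ω) (hb : Bornology.IsBounded Ω) {f : ℂ → ℝ}
    (hf : HarmonicOnNhd f Ω)
    (hfr : ∀ ζ ∈ frontier Ω, ∀ c > 0, ∀ᶠ w in nhdsWithin ζ Ω, f w < c) :
    ∀ w ∈ Ω, f w ≤ 0 := by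
  intro w0 hw0
  by_contra! hpos
  set c := f w0 with hc
  have hcont : ContinuousOn f Ω := hf.continuousOn
  -- superlevel sets are closed
  have key : ∀ S : Set ℝ, IsClosed S → (∀ x ∈ S, c ≤ x) → IsClosed (Ω ∩ f ⁻¹' S) := by
    intro S hS hSc
    rw [← closure_subset_iff_isClosed]
    intro x hx
    have hxΩ : x ∈ Ω := by
      by_contra hxn
      have hxf : x ∈ frontier Ω := by
        rw [hΩ.frontier_eq]
        exact ⟨closure_mono inter_subset_left hx, hxn⟩
      have h1 := hfr x hxf c hpos
      rw [eventually_nhdsWithin_iff] at h1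
      rw [mem_closure_iff_frequently] at hx
      obtain ⟨y, hy1, hy2⟩ := (hx.and_eventually h1).exists
      exact absurd (hSc _ hy1.2) (not_le.2 (hy2 hy1.1))
    refine ⟨hxΩ, ?_⟩
    have hcx : ContinuousAt f x := hcont.continuousAt (hΩ.mem_nhds hxΩ)
    by_contra hxS
    have h2 := hcx.preimage_mem_nhds (hS.isOpen_compl.mem_nhds hxS)
    rw [mem_closure_iff_frequently] at hx
    obtain ⟨y, hy1, hy2⟩ := (hx.and_eventually h2).exists
    exact hy2 hy1.2
  have hK : IsCompact (Ω ∩ f ⁻¹' Set.Ici c) :=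
    Metric.isCompact_of_isClosed_isBounded (key _ isClosed_Ici (fun _ h => h))
      (hb.subset inter_subset_left)
  obtain ⟨p, hp, hpm⟩ := hK.exists_isMaxOn ⟨w0, hw0, le_refl c⟩ (hcont.mono inter_subset_left)
  have hpc : c ≤ f p := hp.2
  have hmax : ∀ w ∈ Ω, f w ≤ f p := by
    intro w hw
    by_cases h : c ≤ f w
    · exact hpm ⟨hw, h⟩
    · linarith
  have hEc : IsClosed (Ω ∩ f ⁻¹' {f p}) := key _ isClosed_singleton (by simpa using hpc)
  have hEo : IsOpen (Ω ∩ f ⁻¹' {f p}) := by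
    rw [isOpen_iff_mem_nhds]
    rintro x ⟨hx, hfx⟩
    obtain ⟨r, hr, hball⟩ := Metric.isOpen_iff.1 hΩ x hx
    obtain ⟨F, hF, hFe⟩ := HarmonicOnNhd.exists_analyticOnNhd_ball_re_eq (hf.mono hball)
    have hxe : f x = f p := hfx
    have hd : ∀ᶠ z in nhds x, DifferentiableAt ℂ (fun z => Complex.exp (F z)) z := by
      filter_upwards [Metric.ball_mem_nhds x hr] with z hz
      exact (hF z hz).differentiableAt.cexp
    have hlm : IsLocalMax (norm ∘ (fun z => Complex.exp (F z))) x := by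
      filter_upwards [Metric.ball_mem_nhds x hr] with z hz
      simp only [Function.comp, Complex.norm_exp]
      have e1 : (F z).re = f z := hFe hz
      have e2 : (F x).re = f x := hFe (Metric.mem_ball_self hr)
      rw [e1, e2, hxe]
      exact Real.exp_le_exp.2 (hmax z (hball hz))
    filter_upwards [Complex.norm_eventually_eq_of_isLocalMax hd hlm, Metric.ball_mem_nhds x hr]
      with z hz hzb
    refine ⟨hball hzb, ?_⟩
    simp only [Complex.norm_exp] at hz
    have e1 : (F z).re = f z := hFe hzb
    have e2 : (F x).re = f x := hFe (Metric.mem_ball_self hr)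
    have := Real.exp_injective hz
    simp only [mem_preimage, mem_singleton_iff]
    linarith
  rcases isClopen_iff.1 ⟨hEc, hEo⟩ with h | h
  · have : p ∈ (∅ : Set ℂ) := h ▸ ⟨hp.1, rfl⟩
    exact this
  · have hb2 : Bornology.IsBounded (Set.univ : Set ℂ) := h ▸ hb.subset inter_subset_left
    exact NormedSpace.unbounded_univ ℂ ℂ hb2

open Real in
lemma poisson_bdry {g : ℂ → ℝ} {R : ℝ} (hR : 0 < R) (hg : ContinuousOn g (Metric.sphere 0 R))
    {ζ : ℂ} (hζ : ζ ∈ Metric.sphere (0:ℂ) R) :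
    Tendsto (fun w => circleAverage (poissonKernel 0 w • g) 0 R) (nhdsWithin ζ (Metric.ball 0 R))
      (nhds (g ζ)) := by
  have habs : |R| = R := abs_of_pos hR
  obtain ⟨M, hM⟩ := (isCompact_sphere (0:ℂ) R).exists_bound_of_continuousOn hg
  have hM0 : 0 ≤ M := (norm_nonneg _).trans (hM ζ hζ)
  rw [Metric.tendsto_nhds]
  intro η hη
  obtain ⟨δ, hδ, hδg⟩ := Metric.continuousWithinAt_iff.1 (hg ζ hζ) (η/2) (by positivity)
  have hnζ : ‖ζ‖ = R := by simpa using hζ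
  have hlim : Tendsto (fun w : ℂ => η/2 + 2 * M * ((R^2 - ‖w‖^2) / (δ/2)^2)) (nhds ζ)
      (nhds (η/2 + 2 * M * ((R^2 - ‖ζ‖^2) / (δ/2)^2))) := by
    apply Continuous.tendsto
    fun_prop
  rw [hnζ] at hlim
  have hev := (hlim.eventually (gt_mem_nhds (show η/2 + 2 * M * ((R^2 - R^2) / (δ/2)^2) < η by
    simp; linarith))).filter_mono (nhdsWithin_le_nhds (s := Metric.ball 0 R))
  filter_upwards [hev, self_mem_nhdsWithin,
    nhdsWithin_le_nhds (Metric.ball_mem_nhds ζ (half_pos hδ))] with w hw1 hw2 hw3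
  have hwR : ‖w‖ < R := by simpa using hw2
  have hPc : ContinuousOn (poissonKernel 0 w) (Metric.sphere 0 |R|) := by
    rw [poissonKernel_eq_re_herglotzRieszKernel]
    exact Complex.continuous_re.comp_continuousOn (continuousOn_herglotzRieszKernel_sphere hw2)
  have hg' : ContinuousOn g (Metric.sphere 0 |R|) := by rwa [habs]
  have hone : circleAverage (poissonKernel 0 w • (fun _ => (1:ℝ))) 0 R = 1 := by
    exact InnerProductSpace.HarmonicOnNhd.circleAverage_poissonKernel_smul
      (f := fun _ => (1:ℝ)) (fun x _ => InnerProductSpace.harmonicAt_const 1) hw2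
  have hP0 : ∀ z ∈ Metric.sphere (0:ℂ) |R|, 0 ≤ poissonKernel 0 w z := by
    intro z hz
    have : ‖z‖ = R := by simpa [habs] using hz
    rw [poissonKernel_def]
    simp only [sub_zero, this]
    apply div_nonneg _ (by positivity)
    nlinarith [norm_nonneg w]
  have hdiff : circleAverage (poissonKernel 0 w • g) 0 R - g ζ =
      circleAverage (fun z => poissonKernel 0 w z * (g z - g ζ)) 0 R := by
    have e1 : (fun z => poissonKernel 0 w z * (g z - g ζ)) =
        (poissonKernel 0 w • g) - g ζ • (poissonKernel 0 w • (fun _ => (1:ℝ))) := by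
      ext z; simp; ring
    rw [e1, circleAverage_sub, circleAverage_smul, hone]
    · simp
    · exact (hPc.smul hg').circleIntegrable'
    · exact ((hPc.smul continuousOn_const).const_smul _).circleIntegrable'
  rw [Real.dist_eq, hdiff]
  refine lt_of_le_of_lt ?_ hw1
  refine (abs_circleAverage_le_circleAverage_abs).trans ?_
  set C := 2 * M * ((R^2 - ‖w‖^2) / (δ/2)^2) with hC
  have hnum : 0 ≤ R^2 - ‖w‖^2 := by nlinarith [norm_nonneg w]
  have hC0 : 0 ≤ C := by positivity
  have hle : ∀ z ∈ Metric.sphere (0:ℂ) |R|,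
      |(fun z : ℂ => poissonKernel 0 w z * (g z - g ζ))| z ≤
        ((η/2) • (poissonKernel 0 w • (fun _ : ℂ => (1:ℝ))) + (fun _ : ℂ => C) : ℂ → ℝ) z := by
    intro z hz
    have hP := hP0 z hz
    have hz' : z ∈ Metric.sphere (0:ℂ) R := by rwa [habs] at hz
    have hzR : ‖z‖ = R := by simpa using hz'
    simp only [Pi.abs_apply, abs_mul, abs_of_nonneg hP, Pi.add_apply, Pi.smul_apply, smul_eq_mul,
      mul_one, Pi.mul_apply]
    by_cases hd : dist z ζ < δ
    · have := hδg hz' hd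
      rw [Real.dist_eq] at this
      nlinarith
    · have hzw : δ/2 ≤ ‖z - w‖ := by
        have h1 := dist_triangle z w ζ
        rw [Metric.mem_ball] at hw3
        rw [← dist_eq_norm]
        linarith
      have hPle : poissonKernel 0 w z ≤ (R^2 - ‖w‖^2) / (δ/2)^2 := by
        rw [poissonKernel_def]
        simp only [sub_zero, hzR]
        gcongr
      have hgd : |g z - g ζ| ≤ 2 * M := by
        have h1 := hM z hz'
        have h2 := hM ζ hζ
        rw [Real.norm_eq_abs, abs_le] at h1 h2
        rw [abs_le]; constructor <;> linarith
      have : poissonKernel 0 w z * |g z - g ζ| ≤ C := by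
        rw [hC, mul_comm (2 * M)]
        gcongr
      have : 0 ≤ η/2 * poissonKernel 0 w z := by positivity
      linarith
  have hi1 : CircleIntegrable ((η/2) • (poissonKernel 0 w • (fun _ => (1:ℝ)))) 0 R :=
    ((hPc.smul continuousOn_const).const_smul _).circleIntegrable'
  have hi2 : CircleIntegrable (fun _ : ℂ => C) 0 R := continuousOn_const.circleIntegrable'
  refine (circleAverage_mono ?_ (hi1.add hi2) hle).trans ?_
  · exact ((hPc.mul (hg'.sub continuousOn_const)).abs).circleIntegrable'
  · rw [circleAverage_add hi1 hi2, circleAverage_smul, hone, circleAverage_const]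
    simp

open Real in
lemma circleAverage_conj {E : Type*} [NormedAddCommGroup E] [NormedSpace ℝ E]
    (f : ℂ → E) (R : ℝ) :
    circleAverage (fun z => f ((starRingEnd ℂ) z)) 0 R = circleAverage f 0 R := by
  rw [circleAverage_eq_circleAverage_zero_one, circleAverage_eq_circleAverage_zero_one (f := f),
    ← circleAverage_zero_one_congr_inv]
  apply circleAverage_congr_sphere
  intro z hz
  have hz1 : ‖z‖ = 1 := by simpa using hz
  simp [Complex.inv_eq_conj hz1]

open Real InnerProductSpace in
lemma ext_odd {ε : ℝ} (hε : 0 < ε) {u : ℂ → ℝ} (hu : HarmonicOnNhd u UHP)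
    (hM : ∃ M, ∀ w ∈ UHP, ‖w‖ < ε → |u w| ≤ M)
    (hc : ContinuousOn u (UHP ∪ (Complex.ofReal '' (Set.Ioo (-ε) 0 ∪ Set.Ioo 0 ε))))
    (h0 : ∀ s ∈ Set.Ioo (-ε) 0 ∪ Set.Ioo 0 ε, u ((s : ℝ) : ℂ) = 0) :
    ∃ ρ > 0, ∃ F : ℂ → ℂ, AnalyticOnNhd ℂ F (Metric.ball 0 ρ) ∧
      (∀ w ∈ Metric.ball (0:ℂ) ρ, 0 < w.im → (F w).re = u w) ∧
      ∀ w ∈ Metric.ball (0:ℂ) ρ, (F ((starRingEnd ℂ) w)).re = - (F w).re := by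
  obtain ⟨M, hM⟩ := hM
  set S := UHP ∪ (Complex.ofReal '' (Set.Ioo (-ε) 0 ∪ Set.Ioo 0 ε)) with hS
  have hopen : IsOpen UHP := isOpen_lt continuous_const Complex.continuous_im
  have hreal : ∀ z : ℂ, z.im = 0 → z ≠ 0 → ‖z‖ < ε → z ∈ S ∧ u z = 0 := by
    intro z hz hz0 hzε
    have hzr : z = ((z.re : ℝ) : ℂ) := by apply Complex.ext <;> simp [hz]
    have hn : |z.re| < ε := by rw [hzr] at hzε; simpa using hzε
    have hne : z.re ≠ 0 := by
      intro h; apply hz0; rw [hzr, h]; simp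
    have hmem : z.re ∈ Set.Ioo (-ε) 0 ∪ Set.Ioo 0 ε := by
      rw [abs_lt] at hn
      rcases lt_or_gt_of_ne hne with h | h
      · exact Or.inl ⟨hn.1, h⟩
      · exact Or.inr ⟨h, hn.2⟩
    refine ⟨Or.inr ⟨z.re, hmem, hzr.symm⟩, ?_⟩
    rw [hzr]; exact h0 _ hmem
  obtain ⟨R, hR, hRε⟩ : ∃ R : ℝ, 0 < R ∧ R < ε := ⟨ε/2, by linarith, by linarith⟩
  have habs : |R| = R := abs_of_pos hR
  have hsph : ∀ z ∈ Metric.sphere (0:ℂ) R, z ≠ 0 ∧ ‖z‖ < ε := by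
    intro z hz
    have : ‖z‖ = R := by simpa using hz
    refine ⟨?_, by linarith⟩
    rintro rfl
    simp at this; linarith
  have hSup : ∀ z ∈ Metric.sphere (0:ℂ) R, 0 ≤ z.im → z ∈ S := by
    intro z hz hi
    rcases hi.lt_or_eq with h | h
    · exact Or.inl h
    · exact (hreal z h.symm (hsph z hz).1 (hsph z hz).2).1
  let g : ℂ → ℝ := fun z => if 0 ≤ z.im then u z else - u ((starRingEnd ℂ) z)
  have hgup : ∀ z, 0 ≤ z.im → g z = u z := fun z hz => if_pos hz
  have hconjS : ∀ z ∈ Metric.sphere (0:ℂ) R, (starRingEnd ℂ) z ∈ Metric.sphere (0:ℂ) R := by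
    intro z hz; simpa using hz
  have hglo : ∀ z ∈ Metric.sphere (0:ℂ) R, z.im ≤ 0 → g z = - u ((starRingEnd ℂ) z) := by
    intro z hz hi
    rcases hi.lt_or_eq with h | h
    · exact if_neg (not_le.2 h)
    · have hcz : (starRingEnd ℂ) z = z := Complex.conj_eq_iff_im.2 h
      rw [hgup z h.ge, hcz, (hreal z h (hsph z hz).1 (hsph z hz).2).2]; simp
  have hgodd : ∀ z ∈ Metric.sphere (0:ℂ) R, g ((starRingEnd ℂ) z) = - g z := by
    intro z hz
    rcases le_total 0 z.im with h | h
    · rw [hgup z h, hglo _ (hconjS z hz) (by simpa using h)]; simp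
    · rw [hglo z hz h, hgup _ (by simpa using h)]; simp
  have hgc : ContinuousOn g (Metric.sphere 0 R) := by
    have hun : Metric.sphere (0:ℂ) R = (Metric.sphere (0:ℂ) R ∩ {z | 0 ≤ z.im}) ∪
        (Metric.sphere (0:ℂ) R ∩ {z | z.im ≤ 0}) := by
      ext z
      constructor
      · intro hz
        rcases le_total 0 z.im with h | h
        · exact Or.inl ⟨hz, h⟩
        · exact Or.inr ⟨hz, h⟩
      · rintro (h | h) <;> exact h.1
    rw [hun]
    apply ContinuousOn.union_of_isClosed
    · exact (hc.mono (fun z hz => hSup z hz.1 hz.2)).congr (fun z hz => hgup z hz.2)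
    · have : ContinuousOn (fun z => - u ((starRingEnd ℂ) z))
          (Metric.sphere (0:ℂ) R ∩ {z | z.im ≤ 0}) := by
        apply ContinuousOn.neg
        apply hc.comp Complex.continuous_conj.continuousOn
        intro z hz
        exact hSup _ (hconjS z hz.1) (by simpa using hz.2)
      exact this.congr (fun z hz => hglo z hz.1 hz.2)
    · exact Metric.isClosed_sphere.inter (isClosed_le continuous_const Complex.continuous_im)
    · exact Metric.isClosed_sphere.inter (isClosed_le Complex.continuous_im continuous_const)
  have hgi : CircleIntegrable g 0 R := hgc.circleIntegrable hR.le
  have hgi' : CircleIntegrable (fun z => (g z : ℂ)) 0 R :=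
    (Complex.continuous_ofReal.comp_continuousOn hgc).circleIntegrable hR.le
  let F : ℂ → ℂ := fun w => circleAverage (fun ζ => herglotzRieszKernel 0 w ζ • (g ζ : ℂ)) 0 R
  have hFa : AnalyticOnNhd ℂ F (Metric.ball 0 R) :=
    analyticOnNhd_circleAverage_herglotzRieszKernel_smul hgi'
  have hFre : ∀ w ∈ Metric.ball (0:ℂ) R,
      (F w).re = circleAverage (poissonKernel 0 w • g) 0 R := by
    intro w hw
    rw [poissonKernel_eq_re_herglotzRieszKernel]
    exact re_circleAverage_herglotzRieszKernel_smul hgi hw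
  have hFodd : ∀ w ∈ Metric.ball (0:ℂ) R, (F ((starRingEnd ℂ) w)).re = - (F w).re := by
    intro w hw
    rw [hFre w hw, hFre _ (by simpa using hw), ← circleAverage_conj, ← neg_one_smul ℝ,
      ← circleAverage_smul]
    apply circleAverage_congr_sphere
    intro z hz
    rw [habs] at hz
    have hk : poissonKernel 0 ((starRingEnd ℂ) w) ((starRingEnd ℂ) z) = poissonKernel 0 w z := by
      simp only [poissonKernel_def, sub_zero, ← map_sub, Complex.norm_conj]
    simp [hk, hgodd z hz]
  refine ⟨R, hR, F, hFa, ?_, hFodd⟩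
  -- the half disc
  let Ω : Set ℂ := Metric.ball 0 R ∩ UHP
  have hΩo : IsOpen Ω := Metric.isOpen_ball.inter hopen
  have hFh : HarmonicOnNhd (fun w => (F w).re) Ω := fun w hw => (hFa w hw.1).harmonicAt_re
  have hlogneg : ∀ w ∈ Ω, Real.log ‖w / (R:ℂ)‖ ≤ 0 := by
    intro w hw
    apply Real.log_nonpos (norm_nonneg _)
    have : ‖w‖ < R := by simpa using hw.1
    rw [norm_div, Complex.norm_real, Real.norm_eq_abs, habs, div_le_one hR]
    exact this.le
  have hΩ0 : ∀ w ∈ Ω, w ≠ 0 := by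
    rintro w hw rfl
    have : (0:ℝ) < (0:ℂ).im := hw.2
    simp at this
  have main : ∀ σ : ℝ, ∀ δ > 0, ∀ w ∈ Ω,
      σ * (u w - (F w).re) + δ * Real.log ‖w / (R:ℂ)‖ ≤ 0 := by
    intro σ δ hδ
    apply harm_max hΩo (Metric.isBounded_ball.subset inter_subset_left)
    · intro w hw
      have h1 : HarmonicAt (fun w => Real.log ‖w / (R:ℂ)‖) w := by
        apply AnalyticAt.harmonicAt_log_norm (f := fun w : ℂ => w / (R:ℂ)) (by fun_prop)
        exact div_ne_zero (hΩ0 w hw) (by exact_mod_cast hR.ne')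
      have h2 : HarmonicAt (u - fun w => (F w).re) w := (hu w hw.2).sub (hFh w hw)
      exact (h2.const_smul (c := σ)).add (h1.const_smul (c := δ))
    · intro ζ hζ c hc0
      rw [hΩo.frontier_eq] at hζ
      obtain ⟨hζc, hζn⟩ := hζ
      have hζ1 : ‖ζ‖ ≤ R := by
        have := closure_mono (inter_subset_left : Ω ⊆ Metric.ball 0 R) hζc
        simpa using Metric.closure_ball_subset_closedBall this
      have hζ2 : 0 ≤ ζ.im := by
        have h1 : Ω ⊆ {z : ℂ | 0 ≤ z.im} := fun z hz => le_of_lt (a := (0:ℝ)) (b := z.im) hz.2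
        exact closure_minimal h1 (isClosed_le continuous_const Complex.continuous_im) hζc
      -- suffices limit zero
      have suff : Tendsto (fun w => u w - (F w).re) (nhdsWithin ζ Ω) (nhds 0) →
          ∀ᶠ w in nhdsWithin ζ Ω, σ * (u w - (F w).re) + δ * Real.log ‖w / (R:ℂ)‖ < c := by
        intro hT
        have hT2 := hT.const_mul σ
        rw [mul_zero] at hT2
        filter_upwards [hT2.eventually (gt_mem_nhds hc0), self_mem_nhdsWithin] with w hw hwΩ
        have := mul_nonneg hδ.le (neg_nonneg.2 (hlogneg w hwΩ))
        linarith
      by_cases hz0 : ζ = 0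
      · subst hz0
        have hFc : ContinuousAt (fun w => (F w).re) 0 :=
          Complex.continuous_re.continuousAt.comp
            (hFa 0 (Metric.mem_ball_self hR)).continuousAt
        have hFb : ∀ᶠ w in nhdsWithin (0:ℂ) Ω, |(F w).re| < |(F 0).re| + 1 :=
          nhdsWithin_le_nhds (hFc.abs.eventually (gt_mem_nhds (by simp)))
        have hlog : Tendsto (fun w : ℂ => Real.log ‖w / (R:ℂ)‖) (nhdsWithin 0 Ω) atBot := by
          apply Real.tendsto_log_nhdsNE_zero.comp
          apply tendsto_nhdsWithin_of_tendsto_nhds_of_eventually_within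
          · have : Continuous (fun w : ℂ => ‖w / (R:ℂ)‖) := by fun_prop
            have := this.tendsto 0
            simp only [zero_div, norm_zero] at this
            exact this.mono_left nhdsWithin_le_nhds
          · filter_upwards [self_mem_nhdsWithin] with w hw
            simp [hΩ0 w hw, hR.ne']
        filter_upwards [hFb, self_mem_nhdsWithin,
          hlog.eventually (eventually_lt_atBot (-(|σ| * (M + (|(F 0).re| + 1))) / δ))]
          with w hw1 hw2 hw3
        have hwR : ‖w‖ < R := by simpa using hw2.1
        have hMw := hM w hw2.2 (by linarith)
        rw [lt_div_iff₀ hδ] at hw3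
        have h4 : |u w - (F w).re| ≤ M + (|(F 0).re| + 1) := by
          have := abs_sub (u w) (F w).re
          linarith
        have h5 : σ * (u w - (F w).re) ≤ |σ| * (M + (|(F 0).re| + 1)) := by
          calc _ ≤ |σ * (u w - (F w).re)| := le_abs_self _
            _ = |σ| * |u w - (F w).re| := abs_mul _ _
            _ ≤ _ := by gcongr
        nlinarith
      · apply suff
        have hζS : ζ ∈ S := by
          rcases hζ2.lt_or_eq with h | h
          · exact Or.inl h
          · exact (hreal ζ h.symm hz0 (by linarith)).1
        have hut : Tendsto u (nhdsWithin ζ Ω) (nhds (u ζ)) :=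
          (hc ζ hζS).mono_left (nhdsWithin_mono _ (fun z hz => Or.inl hz.2))
        rcases hζ1.lt_or_eq with hlt | heq
        · have him : ζ.im = 0 := by
            by_contra hne
            exact hζn ⟨by simpa using hlt, lt_of_le_of_ne hζ2 (Ne.symm hne)⟩
          have hb : ζ ∈ Metric.ball (0:ℂ) R := by simpa using hlt
          have hF0 : (F ζ).re = 0 := by
            have := hFodd ζ hb
            rw [Complex.conj_eq_iff_im.2 him] at this
            linarith
          have hFt : Tendsto (fun w => (F w).re) (nhdsWithin ζ Ω) (nhds 0) := by
            rw [← hF0]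
            exact (Complex.continuous_re.continuousAt.comp
              (hFa ζ hb).continuousAt).tendsto.mono_left nhdsWithin_le_nhds
          rw [(hreal ζ him hz0 (by linarith)).2] at hut
          simpa using hut.sub hFt
        · have hsp : ζ ∈ Metric.sphere (0:ℂ) R := by simpa using heq
          have hFt : Tendsto (fun w => (F w).re) (nhdsWithin ζ Ω) (nhds (u ζ)) := by
            rw [← hgup ζ hζ2]
            have := (poisson_bdry hR hgc hsp).mono_left
              (nhdsWithin_mono ζ (inter_subset_left : Ω ⊆ Metric.ball 0 R))
            apply this.congr'
            filter_upwards [self_mem_nhdsWithin] with w hw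
            exact (hFre w hw.1).symm
          simpa using hut.sub hFt
  have main2 : ∀ σ : ℝ, ∀ w ∈ Ω, σ * (u w - (F w).re) ≤ 0 := by
    intro σ w hw
    have hL := hlogneg w hw
    by_contra! hpos
    set A := σ * (u w - (F w).re)
    set L := Real.log ‖w / (R:ℂ)‖
    have h1 : 0 < 1 - L := by linarith
    have h2 := main σ (A / (1 - L)) (by positivity) w hw
    have h3 : A + A / (1 - L) * L = A / (1 - L) := by field_simp; ring
    have : 0 < A / (1 - L) := by positivity
    linarith
  intro w hw hwi
  have h1 := main2 1 w ⟨hw, hwi⟩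
  have h2 := main2 (-1) w ⟨hw, hwi⟩
  linarith

open InnerProductSpace in
lemma ext_hol {ε : ℝ} (hε : 0 < ε) {h : ℂ → ℂ} (hh : DifferentiableOn ℂ h UHP)
    (hhc : ContinuousOn h (UHP ∪ (Complex.ofReal '' Set.Ioo (-ε) ε)))
    (hreal : ∀ s ∈ Set.Ioo (-ε) ε, (h ((s : ℝ) : ℂ)).im = 0) :
    ∃ ρ > 0, ∃ H : ℂ → ℂ, AnalyticOnNhd ℂ H (Metric.ball 0 ρ) ∧
      (∀ w ∈ Metric.ball (0:ℂ) ρ, 0 < w.im → H w = h w) ∧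
      ∀ w ∈ Metric.ball (0:ℂ) ρ, H ((starRingEnd ℂ) w) = (starRingEnd ℂ) (H w) := by
  have hopen : IsOpen UHP := isOpen_lt continuous_const Complex.continuous_im
  have hha : AnalyticOnNhd ℂ h UHP := hh.analyticOnNhd hopen
  have h0mem : (0:ℂ) ∈ UHP ∪ (Complex.ofReal '' Set.Ioo (-ε) ε) :=
    Or.inr ⟨0, ⟨by linarith, hε⟩, by simp⟩
  obtain ⟨δ, hδ, hδh⟩ := Metric.continuousWithinAt_iff.1 (hhc 0 h0mem) 1 one_pos
  set ε' := min ε δ with hε'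
  have hε'0 : 0 < ε' := lt_min hε hδ
  have hsub : Set.Ioo (-ε') 0 ∪ Set.Ioo 0 ε' ⊆ Set.Ioo (-ε) ε := by
    have : ε' ≤ ε := min_le_left _ _
    rintro s (hs | hs) <;> constructor <;> linarith [hs.1, hs.2]
  obtain ⟨ρ, hρ, F, hF, hFu, hFo⟩ := ext_odd (u := fun w => (h w).im) hε'0
    (fun w hw => (hha w hw).harmonicAt_im)
    ⟨‖h 0‖ + 1, by
      intro w hw hwε
      have h1 := hδh (x := w) (Or.inl hw)
        (by simpa using lt_of_lt_of_le hwε (min_le_right _ _))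
      rw [dist_eq_norm] at h1
      have h2 := Complex.abs_im_le_norm (h w)
      have h3 := norm_sub_norm_le (h w) (h 0)
      linarith⟩
    (Complex.continuous_im.comp_continuousOn (hhc.mono
      (union_subset_union_right _ (image_mono hsub))))
    (fun s hs => hreal s (hsub hs))
  let Ω : Set ℂ := Metric.ball 0 ρ ∩ UHP
  have hΩo : IsOpen Ω := Metric.isOpen_ball.inter hopen
  have hΩc : Convex ℝ Ω := (convex_ball 0 ρ).inter (convex_halfSpace_im_gt 0)
  have hGa : AnalyticOnNhd ℂ (fun w => h w - Complex.I * F w) Ω :=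
    fun w hw => (hha w hw.2).sub (analyticAt_const.mul (hF w hw.1))
  have hG0 : ∀ w ∈ Ω, (h w - Complex.I * F w).im = 0 := by
    intro w hw
    have := hFu w hw.1 hw.2
    simp [this]
  have hp : ((ρ/2 : ℝ) : ℂ) * Complex.I ∈ Ω := by
    constructor
    · simp only [Metric.mem_ball, dist_zero_right, norm_mul, Complex.norm_real, Complex.norm_I,
        mul_one, Real.norm_eq_abs]
      rw [abs_of_pos (by positivity)]; linarith
    · show 0 < (((ρ/2 : ℝ) : ℂ) * Complex.I).im
      simp [hρ]
  obtain ⟨c, hc⟩ := hGa.eq_const_of_im_eq_const hG0 hΩo ⟨⟨_, hp⟩, hΩc.isPreconnected⟩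
  have hcim : c.im = 0 := by
    rw [← hc _ hp]
    exact hG0 _ hp
  let H : ℂ → ℂ := fun w => Complex.I * F w + c
  have hHa : AnalyticOnNhd ℂ H (Metric.ball 0 ρ) :=
    fun w hw => (analyticAt_const.mul (hF w hw)).add analyticAt_const
  refine ⟨ρ, hρ, H, hHa, ?_, ?_⟩
  · intro w hw hwi
    have := hc w ⟨hw, hwi⟩
    simp only [H]
    rw [← this]; ring
  · have hHim : ∀ w ∈ Metric.ball (0:ℂ) ρ, (H ((starRingEnd ℂ) w)).im = - (H w).im := by
      intro w hw
      have := hFo w hw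
      simp [H, hcim, this]
    have hKd : DifferentiableOn ℂ
        (fun w => (starRingEnd ℂ) (H ((starRingEnd ℂ) w)) - H w) (Metric.ball 0 ρ) := by
      intro w hw
      have h1 : DifferentiableAt ℂ H ((starRingEnd ℂ) w) :=
        (hHa _ (by simpa using hw)).differentiableAt
      have h2 := h1.conj_conj
      rw [Complex.conj_conj] at h2
      exact (h2.sub (hHa w hw).differentiableAt).differentiableWithinAt
    have hK0 : ∀ w ∈ Metric.ball (0:ℂ) ρ,
        ((starRingEnd ℂ) (H ((starRingEnd ℂ) w)) - H w).im = 0 := by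
      intro w hw
      simp [hHim w hw]
    obtain ⟨k, hk⟩ := (hKd.analyticOnNhd Metric.isOpen_ball).eq_const_of_im_eq_const hK0
      Metric.isOpen_ball ⟨⟨0, Metric.mem_ball_self hρ⟩, (convex_ball (0:ℂ) ρ).isPreconnected⟩
    have hk0 : k = 0 := by
      have h1 := hk 0 (Metric.mem_ball_self hρ)
      have h2 := hHim 0 (Metric.mem_ball_self hρ)
      rw [map_zero] at h2
      have h3 : (starRingEnd ℂ) (H 0) = H 0 := Complex.conj_eq_iff_im.2 (by linarith)
      simpa [h3] using h1.symm
    intro w hw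
    have := hk w hw
    rw [hk0, sub_eq_zero] at this
    rw [← this, Complex.conj_conj]

open InnerProductSpace in
lemma ext_t {ε : ℝ} (hε : 0 < ε) {a b : ℝ} {t : ℂ → ℝ}
    (ht : HarmonicOnNhd t UHP)
    (htbd : ∃ M : ℝ, ∀ w ∈ UHP, |t w| ≤ M)
    (htc : ContinuousOn t
      (UHP ∪ (Complex.ofReal '' (Set.Ioo (-ε) 0 ∪ Set.Ioo 0 ε))))
    (hta : ∀ s ∈ Set.Ioo (-ε) 0, t ((s : ℝ) : ℂ) = a)
    (htb : ∀ s ∈ Set.Ioo 0 ε, t ((s : ℝ) : ℂ) = b) :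
    ∃ ρ > 0, ∃ F : ℂ → ℂ, AnalyticOnNhd ℂ F (Metric.ball 0 ρ) ∧
      (∀ w ∈ Metric.ball (0:ℂ) ρ, 0 < w.im →
        t w = b + (a - b) / Real.pi * Complex.arg w + (F w).re) ∧
      ∀ w ∈ Metric.ball (0:ℂ) ρ, (F ((starRingEnd ℂ) w)).re = - (F w).re := by
  obtain ⟨M, hM⟩ := htbd
  have hslit : ∀ w ∈ UHP, w ∈ Complex.slitPlane := fun w hw => Or.inr (ne_of_gt hw)
  set k := (a - b) / Real.pi with hk
  have hkpi : k * Real.pi = a - b := by rw [hk]; field_simp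
  obtain ⟨ρ, hρ, F, hF, hFu, hFo⟩ := ext_odd (u := fun w => t w - (b + k * Complex.arg w)) hε
    (by
      intro w hw
      have h1 : HarmonicAt (fun w => (Complex.log w).im) w :=
        (analyticAt_clog (hslit w hw)).harmonicAt_im
      have h2 : HarmonicAt (fun w : ℂ => b) w := harmonicAt_const b
      have h3 := (ht w hw).sub (h2.add (h1.const_smul (c := k)))
      simpa [Complex.log_im, Pi.sub_def, Pi.add_def, Pi.smul_def] using h3)
    ⟨M + (|b| + |k| * Real.pi), by
      intro w hw _
      have h1 := hM w hw
      have h2 := Complex.abs_arg_le_pi w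
      have h3 : |b + k * Complex.arg w| ≤ |b| + |k| * Real.pi := by
        refine (abs_add_le _ _).trans ?_
        rw [abs_mul]; gcongr
      exact (abs_sub _ _).trans (add_le_add h1 h3)⟩
    (by
      refine htc.sub (continuousOn_const.add (continuousOn_const.mul ?_))
      rintro w (hw | ⟨s, hs | hs, rfl⟩)
      · exact (Complex.continuousAt_arg (hslit w hw)).continuousWithinAt
      · apply (Complex.continuousWithinAt_arg_of_re_neg_of_im_zero (by simpa using hs.2)
          (by simp)).mono
        rintro z (hz | ⟨y, _, rfl⟩)
        · exact le_of_lt (a := (0:ℝ)) (b := z.im) hz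
        · simp
      · exact (Complex.continuousAt_arg (Or.inl (by simpa using hs.1))).continuousWithinAt)
    (by
      rintro s (hs | hs)
      · simp only [hta s hs, Complex.arg_ofReal_of_neg hs.2, hkpi]; ring
      · simp only [htb s hs, Complex.arg_ofReal_of_nonneg hs.1.le]; ring)
  refine ⟨ρ, hρ, F, hF, ?_, hFo⟩
  intro w hw hwi
  rw [hFu w hw hwi]; ring

/-- **Reflection across an isotropic line joining two parallel horizontal straight
boundary segments.** If `h` is injective holomorphic on `ℍ`, extending continuously and
injectively to `ℍ ∪ (-ε,ε)` with `h((-ε,ε)) ⊆ ℝ` (the boundary projections lie on the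
`x`-axis), and `t` is bounded harmonic with `t ≡ a` on `(-ε,0)` and `t ≡ b` on `(0,ε)`,
then the real-analytic extension `X̃` of `X ∘ Π` to `ℝ × (0,π)` (`X = (h,t)`,
`Π(r,θ) = r e^{iθ}`) satisfies
`X̃(-r, π-θ) = (conj (h(r e^{iθ})), a + b - t(r e^{iθ}))`: the surface extends across the
isotropic line `L` via the symmetry `(x,y,t) ↦ (x, -y, a+b-t)` with respect to the
horizontal line parallel to the `x`-axis through the midpoint of `L`. -/
theorem zmc_reflection_isotropic_line_between_parallel_lines
    (ε : ℝ) (hε : 0 < ε) (a b : ℝ) (hab : a ≠ b)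
    (h : ℂ → ℂ) (t : ℂ → ℝ)
    (hh : DifferentiableOn ℂ h UHP)
    (hhc : ContinuousOn h (UHP ∪ (Complex.ofReal '' Set.Ioo (-ε) ε)))
    (hhinj : Set.InjOn h (UHP ∪ (Complex.ofReal '' Set.Ioo (-ε) ε)))
    (hreal : ∀ s ∈ Set.Ioo (-ε) ε, (h (s : ℂ)).im = 0)
    (ht : HarmonicOn t UHP)
    (htbd : ∃ M : ℝ, ∀ w ∈ UHP, |t w| ≤ M)
    (htc : ContinuousOn t
      (UHP ∪ (Complex.ofReal '' (Set.Ioo (-ε) 0 ∪ Set.Ioo 0 ε))))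
    (hta : ∀ s ∈ Set.Ioo (-ε) 0, t (s : ℂ) = a)
    (htb : ∀ s ∈ Set.Ioo 0 ε, t (s : ℂ) = b) :
    ∃ X : ℝ × ℝ → ℂ × ℝ,
      AnalyticOnNhd ℝ X (Set.univ ×ˢ Set.Ioo 0 Real.pi) ∧
      (∀ r : ℝ, 0 < r → ∀ θ ∈ Set.Ioo 0 Real.pi,
        X (r, θ) = (h ((r : ℂ) * Complex.exp ((θ : ℂ) * Complex.I)),
                    t ((r : ℂ) * Complex.exp ((θ : ℂ) * Complex.I)))) ∧
      (∀ r : ℝ, 0 < r → ∀ θ ∈ Set.Ioo 0 Real.pi,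
        X (-r, Real.pi - θ) =
          ((starRingEnd ℂ) (h ((r : ℂ) * Complex.exp ((θ : ℂ) * Complex.I))),
           a + b - t ((r : ℂ) * Complex.exp ((θ : ℂ) * Complex.I)))) := by

  have hopen : IsOpen UHP := isOpen_lt continuous_const Complex.continuous_im
  have hha : AnalyticOnNhd ℂ h UHP := hh.analyticOnNhd hopen
  have htH := harm_conv ht
  obtain ⟨ρ₁, hρ₁, H, hH, hHh, hHc⟩ := ext_hol hε hh hhc hreal
  obtain ⟨ρ₂, hρ₂, F, hF, hFt, hFc⟩ := ext_t hε htH htbd htc hta htb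
  let P : ℝ × ℝ → ℂ := fun p => (p.1 : ℂ) * Complex.exp ((p.2 : ℂ) * Complex.I)
  have hPa : ∀ p, AnalyticAt ℝ P p := by
    intro p
    have h1 : AnalyticAt ℝ (fun p : ℝ × ℝ => (p.1 : ℂ)) p :=
      (Complex.ofRealCLM.analyticAt p.1).comp analyticAt_fst
    have h2 : AnalyticAt ℝ (fun p : ℝ × ℝ => (p.2 : ℂ)) p :=
      (Complex.ofRealCLM.analyticAt p.2).comp analyticAt_snd
    have h3 : AnalyticAt ℝ Complex.exp ((p.2 : ℂ) * Complex.I) :=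
      (analyticAt_cexp (z := (p.2 : ℂ) * Complex.I)).restrictScalars
    exact h1.mul (h3.comp (f := fun p : ℝ × ℝ => (p.2 : ℂ) * Complex.I)
      (h2.mul analyticAt_const))
  have hca : ∀ z, AnalyticAt ℝ (starRingEnd ℂ) z := fun z =>
    (Complex.conjCLE.toContinuousLinearMap).analyticAt z
  have hPim : ∀ p, (P p).im = p.1 * Real.sin p.2 := by
    intro p
    simp [P, Complex.exp_ofReal_mul_I_im]
  have hPn : ∀ p, ‖P p‖ = |p.1| := by
    intro p
    simp [P, Complex.norm_exp_ofReal_mul_I]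
  have hPneg : ∀ r θ : ℝ, (starRingEnd ℂ) (P (-r, Real.pi - θ)) = P (r, θ) := by
    intro r θ
    apply Complex.ext
    · simp [P, Complex.exp_re]
    · rw [Complex.conj_im, hPim, hPim]; simp
  have hParg : ∀ r θ : ℝ, 0 < r → θ ∈ Set.Ioo 0 Real.pi → Complex.arg (P (r, θ)) = θ := by
    intro r θ hr hθ
    have := Complex.arg_mul_cos_add_sin_mul_I hr (θ := θ)
      ⟨by linarith [hθ.1, Real.pi_pos], hθ.2.le⟩
    simpa [P, Complex.exp_mul_I] using this
  let X : ℝ × ℝ → ℂ × ℝ := fun p =>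
    if 0 < p.1 then (h (P p), t (P p))
    else if p.1 < 0 then
      ((starRingEnd ℂ) (h ((starRingEnd ℂ) (P p))), a + b - t ((starRingEnd ℂ) (P p)))
    else (H (P p), b + (a - b) / Real.pi * p.2 + (F (P p)).re)
  refine ⟨X, ?_, ?_, ?_⟩
  · rintro ⟨r, θ⟩ ⟨-, hθ⟩
    simp only at hθ
    have hsin : 0 < Real.sin θ := Real.sin_pos_of_mem_Ioo hθ
    rcases lt_trichotomy r 0 with hr | hr | hr
    · have hm : (starRingEnd ℂ) (P (r, θ)) ∈ UHP := by
        show 0 < ((starRingEnd ℂ) (P (r, θ))).im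
        rw [Complex.conj_im, hPim]
        nlinarith
      have hcP : AnalyticAt ℝ (fun p => (starRingEnd ℂ) (P p)) (r, θ) :=
        (hca _).comp (hPa _)
      have h1 : AnalyticAt ℝ (fun p => (starRingEnd ℂ) (h ((starRingEnd ℂ) (P p)))) (r, θ) :=
        (hca _).comp (AnalyticAt.comp (g := h) ((hha _ hm).restrictScalars) hcP)
      have h2 : AnalyticAt ℝ (fun p => a + b - t ((starRingEnd ℂ) (P p))) (r, θ) :=
        analyticAt_const.sub (AnalyticAt.comp (g := t) (HarmonicAt.analyticAt (htH _ hm)) hcP)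
      refine (h1.prod h2).congr ?_
      have : ∀ᶠ p : ℝ × ℝ in nhds (r, θ), p.1 < 0 :=
        continuous_fst.continuousAt.eventually (gt_mem_nhds hr)
      filter_upwards [this] with p hp
      simp only [X, if_neg (not_lt.2 hp.le), if_pos hp]
    · subst hr
      have hP0 : P (0, θ) = 0 := by simp [P]
      have h1 : AnalyticAt ℝ (fun p => H (P p)) ((0:ℝ), θ) :=
        AnalyticAt.comp (g := H)
          (by rw [hP0]; exact (hH 0 (Metric.mem_ball_self hρ₁)).restrictScalars) (hPa _)
      have h2 : AnalyticAt ℝ (fun p => F (P p)) ((0:ℝ), θ) :=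
        AnalyticAt.comp (g := F)
          (by rw [hP0]; exact (hF 0 (Metric.mem_ball_self hρ₂)).restrictScalars) (hPa _)
      have h3 : AnalyticAt ℝ (fun p => (F (P p)).re) ((0:ℝ), θ) :=
        (Complex.reCLM.analyticAt _).comp h2
      have h4 : AnalyticAt ℝ
          (fun p : ℝ × ℝ => b + (a - b) / Real.pi * p.2 + (F (P p)).re) ((0:ℝ), θ) :=
        (analyticAt_const.add (analyticAt_const.mul analyticAt_snd)).add h3
      refine (h1.prod h4).congr ?_
      have e1 : ∀ᶠ p : ℝ × ℝ in nhds ((0:ℝ), θ), |p.1| < min ρ₁ ρ₂ :=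
        (continuous_fst.abs.continuousAt (x := ((0:ℝ), θ))).eventually
          (gt_mem_nhds (by simpa using ⟨hρ₁, hρ₂⟩))
      have e2 : ∀ᶠ p : ℝ × ℝ in nhds ((0:ℝ), θ), p.2 ∈ Set.Ioo 0 Real.pi :=
        continuous_snd.continuousAt.eventually (isOpen_Ioo.mem_nhds hθ)
      filter_upwards [e1, e2] with p hp1 hp2
      have hs : 0 < Real.sin p.2 := Real.sin_pos_of_mem_Ioo hp2
      have hb1 : P p ∈ Metric.ball (0:ℂ) ρ₁ := by
        simpa [hPn] using lt_of_lt_of_le hp1 (min_le_left _ _)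
      have hb2 : P p ∈ Metric.ball (0:ℂ) ρ₂ := by
        simpa [hPn] using lt_of_lt_of_le hp1 (min_le_right _ _)
      rcases lt_trichotomy p.1 0 with hr | hr | hr
      · simp only [X, if_neg (not_lt.2 hr.le), if_pos hr]
        have hm : 0 < ((starRingEnd ℂ) (P p)).im := by
          rw [Complex.conj_im, hPim]
          nlinarith
        have hb1' : (starRingEnd ℂ) (P p) ∈ Metric.ball (0:ℂ) ρ₁ := by simpa using hb1
        have hb2' : (starRingEnd ℂ) (P p) ∈ Metric.ball (0:ℂ) ρ₂ := by simpa using hb2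
        have harg : Complex.arg ((starRingEnd ℂ) (P p)) = Real.pi - p.2 := by
          have h5 := hPneg (-p.1) (Real.pi - p.2)
          simp only [neg_neg, sub_sub_cancel, Prod.mk.eta] at h5
          rw [h5]
          exact hParg _ _ (by linarith) ⟨by linarith [hp2.2], by linarith [hp2.1]⟩
        rw [← hHh _ hb1' hm, hHc _ hb1, Complex.conj_conj, hFt _ hb2' hm, hFc _ hb2, harg]
        congr 1
        field_simp
        ring
      · simp only [X, hr, lt_irrefl, if_false]
      · simp only [X, if_pos hr]
        have hm : 0 < (P p).im := by rw [hPim]; positivity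
        have harg : Complex.arg (P p) = p.2 := hParg p.1 p.2 hr hp2
        rw [← hHh _ hb1 hm, hFt _ hb2 hm, harg]
    · have hm : P (r, θ) ∈ UHP := by
        show 0 < (P (r, θ)).im
        rw [hPim]; positivity
      have h1 : AnalyticAt ℝ (fun p => h (P p)) (r, θ) :=
        AnalyticAt.comp (g := h) ((hha _ hm).restrictScalars) (hPa _)
      have h2 : AnalyticAt ℝ (fun p => t (P p)) (r, θ) :=
        AnalyticAt.comp (g := t) (HarmonicAt.analyticAt (htH _ hm)) (hPa _)
      refine (h1.prod h2).congr ?_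
      have : ∀ᶠ p : ℝ × ℝ in nhds (r, θ), 0 < p.1 :=
        continuous_fst.continuousAt.eventually (lt_mem_nhds hr)
      filter_upwards [this] with p hp
      simp only [X, if_pos hp]
  · intro r hr θ _
    simp only [X, if_pos hr, P]
  · intro r hr θ _
    have h1 : ¬ (0 < -r) := by linarith
    have h2 : -r < 0 := by linarith
    simp only [X, if_neg h1, if_pos h2, hPneg]
    rfl
end
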